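/- There exists a constant C₀ ≥ 20 such that for every C ≥ C₀ and all sufficiently large N: E_{f, x ~ C_f}[ Pr[ R_f outputs x ] ] ≥ (1 + ε²/8)/N, where f is drawn from the marginal of D on the first function and the probability is over the randomness of R_f (including the draw g ~ D_f). -/

import Mathlib

open MeasureTheory ProbabilityTheory Finset

noncomputable section

/-- Bit strings of length `n`; there are `N = 2^n` of them. -/
abbrev BV (n : ℕ) := Fin n → Bool

/-- Inner product (mod nothing, just the count) of two bit strings. -/
def bip {n : ℕ} (x y : BV n) : ℕ := (Finset.univ.filter fun i => x i && y i).card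

/-- The `N × N` normalized Walsh-Hadamard matrix, `H_{x,y} = (-1)^{⟨x,y⟩} / √N`. -/
def Had (n : ℕ) : Matrix (BV n) (BV n) ℝ :=
  Matrix.of fun x y => (-1 : ℝ) ^ bip x y / Real.sqrt (2 ^ n)

/-- `ε = 1 / (C ln N)` with `N = 2^n`. -/
def eps (C : ℝ) (n : ℕ) : ℝ := 1 / (C * Real.log (2 ^ n))

/-- The Gaussian vector `X` with i.i.d. `N(0, ε)` coordinates. -/
def gaussVec (C : ℝ) (n : ℕ) : Measure (BV n → ℝ) :=
  Measure.pi fun _ => gaussianReal 0 (eps C n).toNNReal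

/-- The distribution `G'` of `Z = (X, Y∘Y - ε·𝟙)` with `Y = H·X`, packed as a
function on `BV n ⊕ BV n` (first `N` coordinates are `X`, last `N` are `Y∘Y - ε`). -/
def Gmeas' (C : ℝ) (n : ℕ) : Measure (BV n ⊕ BV n → ℝ) :=
  (gaussVec C n).map fun X => Sum.elim X fun i => ((Had n).mulVec X i) ^ 2 - eps C n

/-- Truncation to `[-1, 1]`. -/
def trnc (a : ℝ) : ℝ := min 1 (max (-1) a)

/-- Randomized rounding of `a` to `±1`: output `1` with probability `(1 + trnc a)/2`
and `-1` with probability `(1 - trnc a)/2`. -/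
def roundM (a : ℝ) : Measure ℝ :=
  ((1 + trnc a) / 2).toNNReal • Measure.dirac 1 +
    ((1 - trnc a) / 2).toNNReal • Measure.dirac (-1)

/-- The distribution `D` on `{±1}^{2N}`: sample `z ~ G'` and round each coordinate
independently. -/
def Dmeas (C : ℝ) (n : ℕ) : Measure (BV n ⊕ BV n → ℝ) :=
  (Gmeas' C n).bind fun z => Measure.pi fun i => roundM (z i)

/-- `F : ℝ^ι → ℝ` is multilinear if `F z = Σ_S F̂(S) ∏_{i ∈ S} z_i`. -/
def IsMultilinear {ι : Type*} [Fintype ι] [DecidableEq ι] (F : (ι → ℝ) → ℝ) : Prop :=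
  ∃ c : Finset ι → ℝ, ∀ z, F z = ∑ S : Finset ι, c S * ∏ i ∈ S, z i

/-- The Fourier coefficient `F̂(S)` of `F` (over the hypercube `{±1}^ι`); for a
multilinear `F` these are precisely its multilinear coefficients. -/
def mlCoeff {ι : Type*} [Fintype ι] [DecidableEq ι] (F : (ι → ℝ) → ℝ) (S : Finset ι) : ℝ :=
  (∑ z : ι → Bool, F (fun i => if z i then 1 else -1) * ∏ i ∈ S, (if z i then (1 : ℝ) else -1)) /
    2 ^ Fintype.card ι

/-- `L_{1,2}(F) = Σ_{|S| = 2} |F̂(S)|`. -/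
def L12 {ι : Type*} [Fintype ι] [DecidableEq ι] (F : (ι → ℝ) → ℝ) : ℝ :=
  ∑ S ∈ Finset.univ.filter (fun S : Finset ι => S.card = 2), |mlCoeff F S|

/-- The restriction `F_ρ` of `F` under `ρ = (S, w)`: coordinates outside `S` are
fixed to the values of `w`. -/
def restrictML {ι : Type*} [DecidableEq ι] (F : (ι → ℝ) → ℝ) (S : Finset ι)
    (w : ι → ℝ) : (ι → ℝ) → ℝ :=
  fun y => F fun i => if i ∈ S then y i else w i

/-- `φ(X, Y) = (1/N) Σ_i (Σ_j H_{ij} X_j)² Y_i`. -/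
def phi (n : ℕ) (X Y : BV n → ℝ) : ℝ :=
  (∑ i, ((Had n).mulVec X i) ^ 2 * Y i) / 2 ^ n

/-- The multilinear part `φ_{i≠j}(X, Y) = (1/N) Σ_i Σ_{j ≠ k} H_{ij} H_{ik} X_j X_k Y_i`. -/
def phiOff (n : ℕ) (X Y : BV n → ℝ) : ℝ :=
  (∑ i, ∑ j, ∑ k ∈ Finset.univ \ {j}, Had n i j * Had n i k * X j * X k * Y i) / 2 ^ n

/-- The Fourier coefficient `f̂(x) = 2^{-n} Σ_y f(y) (-1)^{⟨x,y⟩}` of `f : {0,1}^n → {±1}`. -/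
def hatF (n : ℕ) (f : BV n → ℝ) (x : BV n) : ℝ :=
  (∑ y, f y * (-1 : ℝ) ^ bip x y) / 2 ^ n

/-- The fraction of points where `g` equals `1`. -/
def selProb (n : ℕ) (g : BV n → ℝ) : ℝ :=
  ((Finset.univ.filter fun y : BV n => g y = 1).card : ℝ) / 2 ^ n

/-- The probability that the rejection-sampling procedure (for a fixed `g`) outputs `x`:
draw up to `4 n²` i.i.d. uniform points and output the first one where `g = 1`; if all
attempts fail, output a fresh uniform point. -/
def rejProb (n : ℕ) (g : BV n → ℝ) (x : BV n) : ℝ :=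
  (∑ k ∈ Finset.range (4 * n ^ 2), (1 - selProb n g) ^ k) *
      (if g x = 1 then (1 : ℝ) else 0) / 2 ^ n
    + (1 - selProb n g) ^ (4 * n ^ 2) / 2 ^ n

section Hadamard

lemma neg_one_pow_bip {n : ℕ} (x y : BV n) :
    (-1 : ℝ) ^ bip x y = ∏ i, if x i && y i then (-1 : ℝ) else 1 := by
  rw [Finset.prod_ite]
  simp [bip]

lemma bip_comm {n : ℕ} (x y : BV n) : bip x y = bip y x := by
  simp only [bip, Bool.and_comm]

lemma Had_transpose (n : ℕ) : (Had n).transpose = Had n := by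
  ext x y
  simp [Had, bip_comm x y]

lemma sum_neg_one_pow_bip_mul {n : ℕ} (x x' : BV n) :
    ∑ y : BV n, (-1 : ℝ) ^ bip x y * (-1 : ℝ) ^ bip x' y = if x = x' then 2 ^ n else 0 := by
  have h : ∀ y : BV n, (-1 : ℝ) ^ bip x y * (-1 : ℝ) ^ bip x' y =
      ∏ i, ((if x i && y i then (-1 : ℝ) else 1) * (if x' i && y i then (-1 : ℝ) else 1)) := by
    intro y
    rw [neg_one_pow_bip, neg_one_pow_bip, Finset.prod_mul_distrib]
  simp_rw [h]
  have h2 := (Fintype.prod_sum (fun (i : Fin n) (b : Bool) =>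
    ((if x i && b then (-1 : ℝ) else 1) * (if x' i && b then (-1 : ℝ) else 1))))
  rw [← h2]
  have h3 : ∀ i, (∑ b : Bool, ((if x i && b then (-1 : ℝ) else 1) *
      (if x' i && b then (-1 : ℝ) else 1))) = if x i = x' i then 2 else 0 := by
    intro i
    cases x i <;> cases x' i <;> norm_num
  simp_rw [h3]
  split_ifs with hx
  · subst hx; simp
  · obtain ⟨i, hi⟩ := Function.ne_iff.mp hx
    exact Finset.prod_eq_zero (Finset.mem_univ i) (by simp [hi])

lemma Had_mul_Had (n : ℕ) : Had n * Had n = 1 := by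
  ext x y
  have hs : Real.sqrt (2 ^ n) * Real.sqrt (2 ^ n) = 2 ^ n := Real.mul_self_sqrt (by positivity)
  rw [Matrix.mul_apply, Matrix.one_apply]
  have h : ∀ j, Had n x j * Had n j y =
      ((-1 : ℝ) ^ bip x j * (-1 : ℝ) ^ bip y j) / 2 ^ n := by
    intro j
    simp only [Had, Matrix.of_apply]
    rw [div_mul_div_comm, hs, bip_comm j y]
  simp_rw [h]
  rw [← Finset.sum_div, sum_neg_one_pow_bip_mul]
  split_ifs <;> simp

lemma sum_Had_mulVec_sq (n : ℕ) (v : BV n → ℝ) :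
    ∑ i, ((Had n).mulVec v i) ^ 2 = ∑ i, v i ^ 2 := by
  have h : dotProduct ((Had n).mulVec v) ((Had n).mulVec v) = dotProduct v v := by
    rw [Matrix.dotProduct_mulVec, ← Matrix.mulVec_transpose, Had_transpose,
      Matrix.mulVec_mulVec, Had_mul_Had, Matrix.one_mulVec]
  simpa [dotProduct, pow_two] using h

lemma Had_sq (n : ℕ) (i j : BV n) : Had n i j ^ 2 = 1 / 2 ^ n := by
  simp only [Had, Matrix.of_apply]
  rw [div_pow, Real.sq_sqrt (by positivity), ← pow_mul, mul_comm, pow_mul]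
  simp

lemma sum_Had_sq (n : ℕ) (i : BV n) : ∑ j, Had n i j ^ 2 = 1 := by
  simp [Had_sq]

lemma hatF_sq (n : ℕ) (f : BV n → ℝ) (x : BV n) :
    hatF n f x ^ 2 = ((Had n).mulVec f x) ^ 2 / 2 ^ n := by
  have h : hatF n f x = (Had n).mulVec f x / Real.sqrt (2 ^ n) := by
    have hs : Real.sqrt (2 ^ n) * Real.sqrt (2 ^ n) = 2 ^ n := Real.mul_self_sqrt (by positivity)
    simp only [hatF, Matrix.mulVec, dotProduct, Had, Matrix.of_apply]
    rw [Finset.sum_div, Finset.sum_div]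
    refine Finset.sum_congr rfl fun y _ => ?_
    rw [div_mul_eq_mul_div, div_div, hs, bip_comm, mul_comm]
  rw [h, div_pow, Real.sq_sqrt (by positivity)]

lemma sum_hatF_sq (n : ℕ) (f : BV n → ℝ) (hf : ∀ x, f x = 1 ∨ f x = -1) :
    ∑ x, hatF n f x ^ 2 = 1 := by
  simp_rw [hatF_sq]
  rw [← Finset.sum_div, sum_Had_mulVec_sq]
  have h : ∀ i, f i ^ 2 = 1 := fun i => by rcases hf i with h | h <;> simp [h]
  simp [h]

end Hadamard

section Rejection

/-- The average of a function on bit strings. -/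
def avg (n : ℕ) (v : BV n → ℝ) : ℝ := (∑ i, v i) / 2 ^ n

lemma selProb_eq (n : ℕ) (g : BV n → ℝ) (hg : ∀ x, g x = 1 ∨ g x = -1) :
    selProb n g = (1 + avg n g) / 2 := by
  have h : ∀ x, g x = 2 * (if g x = 1 then (1 : ℝ) else 0) - 1 := by
    intro x
    rcases hg x with h | h <;> rw [h] <;> norm_num
  have h2 : ∑ x, g x = 2 * ((Finset.univ.filter fun y : BV n => g y = 1).card : ℝ) - 2 ^ n := by
    rw [Finset.sum_congr rfl fun x _ => h x, Finset.sum_sub_distrib, ← Finset.mul_sum,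
      Finset.sum_boole]
    simp
  rw [selProb, avg, h2]
  field_simp
  ring

lemma abs_avg_le_one (n : ℕ) (g : BV n → ℝ) (hg : ∀ x, g x = 1 ∨ g x = -1) :
    |avg n g| ≤ 1 := by
  rw [avg, abs_div, div_le_one (by positivity), abs_of_pos (by positivity : (0 : ℝ) < 2 ^ n)]
  refine (Finset.abs_sum_le_sum_abs _ _).trans ?_
  have h : ∀ x, |g x| = 1 := fun x => by rcases hg x with h | h <;> simp [h]
  simp [h]

lemma sum_range_mul_half_pow (m : ℕ) :
    ∑ k ∈ Finset.range m, (k : ℝ) * (1 / 2) ^ (k - 1) = 4 - 4 * (m + 1) * (1 / 2) ^ m := by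
  induction m with
  | zero => simp
  | succ m ih =>
    rw [Finset.sum_range_succ, ih]
    cases m with
    | zero => norm_num
    | succ m => push_cast; simp only [pow_succ]; ring

lemma half_pow_tangent (q : ℝ) (hq : 0 ≤ q) (k : ℕ) :
    (1 / 2 : ℝ) ^ k + k * (1 / 2) ^ (k - 1) * (q - 1 / 2) ≤ q ^ k := by
  cases k with
  | zero => simp
  | succ k =>
    have h := one_add_mul_le_pow (a := 2 * q - 1) (by linarith) (k + 1)
    have h2 : (q : ℝ) ^ (k + 1) = (1 / 2) ^ (k + 1) * (1 + (2 * q - 1)) ^ (k + 1) := by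
      rw [← mul_pow]; congr 1; ring
    rw [h2]
    refine le_trans (le_of_eq ?_) (mul_le_mul_of_nonneg_left h (by positivity))
    simp only [Nat.add_sub_cancel, pow_succ]
    push_cast
    ring

lemma sum_range_pow_lower (m : ℕ) (a : ℝ) (ha : |a| ≤ 1) :
    2 - 2 * (1 / 2) ^ m - 2 * |a| ≤ ∑ k ∈ Finset.range m, (1 - (1 + a) / 2) ^ k := by
  have h1 := abs_le.mp ha
  have h2 : ∑ k ∈ Finset.range m, ((1 / 2 : ℝ) ^ k + k * (1 / 2) ^ (k - 1) * (-a / 2)) ≤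
      ∑ k ∈ Finset.range m, (1 - (1 + a) / 2) ^ k := by
    refine Finset.sum_le_sum fun k _ => ?_
    rw [show -a / 2 = 1 - (1 + a) / 2 - 1 / 2 by ring]
    exact half_pow_tangent (1 - (1 + a) / 2) (by linarith) k
  refine le_trans ?_ h2
  rw [Finset.sum_add_distrib, ← Finset.sum_mul, sum_range_mul_half_pow, geom_sum_eq (by norm_num)]
  have hT : (m + 1 : ℝ) * (1 / 2) ^ m ≤ 1 := by
    have := one_add_mul_le_pow (a := (1 : ℝ)) (by norm_num) m
    rw [one_div, inv_pow]
    rw [mul_inv_le_iff₀ (by positivity)]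
    norm_num at this
    linarith
  have hT0 : 0 ≤ (m + 1 : ℝ) * (1 / 2) ^ m := by positivity
  have h3 : (4 - 4 * (m + 1 : ℝ) * (1 / 2) ^ m) * (a / 2) ≤ 2 * |a| := by
    have : a ≤ |a| := le_abs_self a
    nlinarith [abs_nonneg a]
  have : ((1 / 2 : ℝ) ^ m - 1) / (1 / 2 - 1) = 2 - 2 * (1 / 2) ^ m := by
    ring
  rw [this]
  linarith

/-- The correlation `∑ₓ f̂(x)² g(x)`. -/
def corr (n : ℕ) (f g : BV n → ℝ) : ℝ := ∑ x, hatF n f x ^ 2 * g x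

lemma corr_le_one (n : ℕ) (f g : BV n → ℝ) (hf : ∀ x, f x = 1 ∨ f x = -1)
    (hg : ∀ x, g x = 1 ∨ g x = -1) : |corr n f g| ≤ 1 := by
  rw [corr, ← sum_hatF_sq n f hf]
  refine (Finset.abs_sum_le_sum_abs _ _).trans (le_of_eq ?_)
  refine Finset.sum_congr rfl fun x _ => ?_
  rcases hg x with h | h <;> simp [h]

lemma rejection_lower (n : ℕ) (f g : BV n → ℝ) (hf : ∀ x, f x = 1 ∨ f x = -1)
    (hg : ∀ x, g x = 1 ∨ g x = -1) (η : ℝ) (hη : 0 < η) :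
    (1 + corr n f g - 2 * (1 / 2) ^ (4 * n ^ 2) - η - avg n g ^ 2 / η) / 2 ^ n ≤
      ∑ x, hatF n f x ^ 2 * rejProb n g x := by
  have ha := abs_avg_le_one n g hg
  have hc := abs_le.mp (corr_le_one n f g hf hg)
  set a := avg n g with ha_def
  set S := ∑ k ∈ Finset.range (4 * n ^ 2), (1 - (1 + a) / 2) ^ k with hS
  have hSl := sum_range_pow_lower (4 * n ^ 2) a ha
  rw [← hS] at hSl
  have hq : 0 ≤ (1 - (1 + a) / 2) ^ (4 * n ^ 2) := by
    have := abs_le.mp ha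
    exact pow_nonneg (by linarith) _
  have hrej : ∀ x, rejProb n g x =
      (S * ((1 + g x) / 2) + (1 - (1 + a) / 2) ^ (4 * n ^ 2)) / 2 ^ n := by
    intro x
    have hite : (if g x = 1 then (1 : ℝ) else 0) = (1 + g x) / 2 := by
      rcases hg x with h | h <;> rw [h] <;> norm_num
    rw [rejProb, selProb_eq n g hg, ← ha_def, ← hS, hite]
    ring
  have hsum : ∑ x, hatF n f x ^ 2 * rejProb n g x =
      (S * ((1 + corr n f g) / 2) + (1 - (1 + a) / 2) ^ (4 * n ^ 2)) / 2 ^ n := by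
    have h1 : ∀ x, hatF n f x ^ 2 * rejProb n g x =
        ((S / 2 + (1 - (1 + a) / 2) ^ (4 * n ^ 2)) * hatF n f x ^ 2 +
          S / 2 * (hatF n f x ^ 2 * g x)) / 2 ^ n := by
      intro x; rw [hrej]; ring
    simp_rw [h1]
    rw [← Finset.sum_div, Finset.sum_add_distrib, ← Finset.mul_sum, ← Finset.mul_sum,
      sum_hatF_sq n f hf]
    rw [← corr]
    ring
  rw [hsum]
  refine div_le_div_of_nonneg_right ?_ (by positivity)
  have hη2 : 2 * |a| ≤ η + a ^ 2 / η := by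
    have h : η + a ^ 2 / η - 2 * |a| = (η - |a|) ^ 2 / η := by
      field_simp
      rw [sub_sq, sq_abs]; ring
    have : 0 ≤ (η - |a|) ^ 2 / η := by positivity
    linarith
  have hm : 0 ≤ (1 / 2 : ℝ) ^ (4 * n ^ 2) := by positivity
  nlinarith [mul_le_mul_of_nonneg_right hSl (by linarith [hc.1] : 0 ≤ (1 + corr n f g) / 2),
    mul_nonneg (by linarith [hc.2] : 0 ≤ 1 - corr n f g) (by positivity : 0 ≤ 2 * (1 / 2 : ℝ) ^ (4 * n ^ 2) + 2 * |a|)]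

end Rejection

section Rounding

lemma neg_one_le_trnc (a : ℝ) : -1 ≤ trnc a := le_min (by norm_num) (le_max_left _ _)

lemma trnc_le_one (a : ℝ) : trnc a ≤ 1 := min_le_left _ _

lemma trnc_sq_le_one (a : ℝ) : trnc a ^ 2 ≤ 1 := by
  nlinarith [neg_one_le_trnc a, trnc_le_one a]

lemma continuous_trnc : Continuous trnc := by
  unfold trnc
  fun_prop

instance (a : ℝ) : IsProbabilityMeasure (roundM a) := by
  constructor
  have h1 : (0 : ℝ) ≤ (1 + trnc a) / 2 := by linarith [neg_one_le_trnc a]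
  have h2 : (0 : ℝ) ≤ (1 - trnc a) / 2 := by linarith [trnc_le_one a]
  simp only [roundM, Measure.add_apply, Measure.smul_apply, measure_univ]
  simp only [ENNReal.smul_def, smul_eq_mul, mul_one]
  rw [← ENNReal.coe_add, ← Real.toNNReal_add h1 h2]
  norm_num
  ring

lemma ae_roundM (a : ℝ) : ∀ᵐ x ∂(roundM a), x = 1 ∨ x = -1 := by
  rw [roundM, ae_add_measure_iff]
  constructor <;> refine Measure.ae_smul_measure ?_ _ <;> simp [ae_dirac_eq]

lemma integral_roundM (a : ℝ) : ∫ x, x ∂(roundM a) = trnc a := by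
  have h1 : (0 : ℝ) ≤ (1 + trnc a) / 2 := by linarith [neg_one_le_trnc a]
  have h2 : (0 : ℝ) ≤ (1 - trnc a) / 2 := by linarith [trnc_le_one a]
  rw [roundM, integral_add_measure, integral_smul_nnreal_measure, integral_smul_nnreal_measure,
    integral_dirac, integral_dirac]
  · simp only [NNReal.smul_def, Real.coe_toNNReal _ h1, Real.coe_toNNReal _ h2, smul_eq_mul]
    ring
  · exact (integrable_dirac (by simp)).smul_measure_nnreal
  · exact (integrable_dirac (by simp)).smul_measure_nnreal

lemma measurable_roundM : Measurable roundM := by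
  refine Measure.measurable_of_measurable_coe _ fun s _ => ?_
  have ht := continuous_trnc.measurable
  simp only [roundM, Measure.add_apply, Measure.smul_apply, ENNReal.smul_def, smul_eq_mul]
  fun_prop

variable {ι : Type*} [Fintype ι]

/-- The kernel rounding each coordinate independently to `±1`. -/
def roundKernel (ι : Type*) [Fintype ι] : Kernel (ι → ℝ) (ι → ℝ) where
  toFun z := Measure.pi fun i => roundM (z i)
  measurable' := by
    refine Measurable.measure_of_isPiSystem_of_isProbabilityMeasure generateFrom_pi.symm
      isPiSystem_pi ?_
    rintro _ ⟨s, hs, rfl⟩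
    simp_rw [Measure.pi_pi]
    refine Finset.measurable_prod _ fun i _ => ?_
    have hsi : MeasurableSet (s i) := hs i (Set.mem_univ i)
    exact (Measure.measurable_coe hsi).comp
      (measurable_roundM.comp (measurable_pi_apply i))

lemma roundKernel_apply (z : ι → ℝ) :
    roundKernel ι z = Measure.pi fun i => roundM (z i) := rfl

instance : IsMarkovKernel (roundKernel ι) where
  isProbabilityMeasure z := by rw [roundKernel_apply]; infer_instance

/-- The set of `±1` vectors. -/
def cube (ι : Type*) : Set (ι → ℝ) := {z | ∀ i, z i = 1 ∨ z i = -1}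

lemma finite_cube : (cube ι).Finite := by
  have h : (cube ι) = Set.univ.pi fun _ => ({1, -1} : Set ℝ) := by
    ext z; simp [cube, Set.mem_pi]
  rw [h]
  exact Set.Finite.pi fun _ => Set.toFinite ({1, -1} : Set ℝ)

lemma measurableSet_cube : MeasurableSet (cube ι) := finite_cube.measurableSet

lemma ae_roundKernel (z : ι → ℝ) : ∀ᵐ w ∂(roundKernel ι z), w ∈ cube ι := by
  rw [roundKernel_apply]
  simp only [cube, Set.mem_ofPred_eq]
  rw [ae_all_iff]
  intro i
  exact (measurePreserving_eval (fun i => roundM (z i)) i).quasiMeasurePreserving.ae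
    (ae_roundM (z i))

lemma integrable_of_ae_cube {μ : Measure (ι → ℝ)} [IsFiniteMeasure μ]
    (h : ∀ᵐ w ∂μ, w ∈ cube ι) (F : (ι → ℝ) → ℝ) : Integrable F μ := by
  have h2 : IntegrableOn F (cube ι) μ := IntegrableOn.of_finite finite_cube
  rwa [IntegrableOn, Measure.restrict_eq_self_of_ae_mem h] at h2

lemma integral_roundKernel_prod [DecidableEq ι] (z : ι → ℝ) (S : Finset ι) :
    ∫ w, ∏ i ∈ S, w i ∂(roundKernel ι z) = ∏ i ∈ S, trnc (z i) := by
  have h := integral_fintype_prod_eq_prod (𝕜 := ℝ) (μ := fun i => roundM (z i))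
    (fun i x => if i ∈ S then x else 1)
  rw [roundKernel_apply]
  have h1 : ∀ i, ∫ x, (if i ∈ S then x else 1) ∂(roundM (z i)) = if i ∈ S then trnc (z i) else 1 := by
    intro i
    split_ifs
    · exact integral_roundM _
    · simp
  simp_rw [h1] at h
  simpa [Finset.prod_ite_mem] using h

lemma integral_bind_roundKernel {μ : Measure (ι → ℝ)} [IsProbabilityMeasure μ]
    (F : (ι → ℝ) → ℝ) (hF : Integrable F (μ.bind (roundKernel ι))) :
    Integrable (fun z => ∫ w, F w ∂(roundKernel ι z)) μ ∧
    ∫ w, F w ∂(μ.bind (roundKernel ι)) = ∫ z, ∫ w, F w ∂(roundKernel ι z) ∂μ := by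
  have h : (roundKernel ι ∘ₖ Kernel.const Unit μ) () = μ.bind (roundKernel ι) := by
    rw [Kernel.comp_apply, Kernel.const_apply]
  rw [← h] at hF
  refine ⟨?_, ?_⟩
  · simpa using hF.integral_comp
  · rw [← h, Kernel.integral_comp hF, Kernel.const_apply]

lemma ae_bind_roundKernel {μ : Measure (ι → ℝ)} :
    ∀ᵐ w ∂(μ.bind (roundKernel ι)), w ∈ cube ι := by
  rw [ae_iff]
  have : {a | ¬ a ∈ cube ι} = (cube ι)ᶜ := rfl
  rw [this, Measure.bind_apply measurableSet_cube.compl (roundKernel ι).measurable.aemeasurable]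
  refine (lintegral_congr fun z => ?_).trans lintegral_zero
  exact ae_iff.mp (ae_roundKernel z)

end Rounding

section ConditionalExpectation

lemma integral_roundKernel_pair {ι : Type*} [Fintype ι] [DecidableEq ι] (z : ι → ℝ) (j k : ι) :
    ∫ w, w j * w k ∂(roundKernel ι z) = if j = k then 1 else trnc (z j) * trnc (z k) := by
  split_ifs with h
  · subst h
    rw [integral_congr_ae (g := fun _ => (1 : ℝ))]
    · simp
    · filter_upwards [ae_roundKernel z] with w hw
      rcases hw j with h | h <;> simp [h]
  · have := integral_roundKernel_prod z {j, k}
    simpa [Finset.prod_pair h] using this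

lemma integral_roundKernel_triple {ι : Type*} [Fintype ι] [DecidableEq ι] (z : ι → ℝ) (j k i : ι)
    (hj : j ≠ i) (hk : k ≠ i) :
    ∫ w, w j * w k * w i ∂(roundKernel ι z) =
      (if j = k then 1 else trnc (z j) * trnc (z k)) * trnc (z i) := by
  split_ifs with h
  · subst h
    rw [integral_congr_ae (g := fun w => w i), one_mul]
    · simpa using integral_roundKernel_prod z {i}
    · filter_upwards [ae_roundKernel z] with w hw
      rcases hw j with h | h <;> simp [h]
  · have := integral_roundKernel_prod z {j, k, i}
    rw [Finset.prod_insert (by simp [h, hj]), Finset.prod_pair hk] at this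
    rw [mul_assoc, ← this]
    congr 1
    ext w
    rw [Finset.prod_insert (by simp [h, hj]), Finset.prod_pair hk, mul_assoc]

lemma sum_sum_ite_eq {κ : Type*} [Fintype κ] [DecidableEq κ] (c t : κ → ℝ) :
    ∑ j, ∑ k, c j * c k * (if j = k then 1 else t j * t k) =
      (∑ j, c j * t j) ^ 2 + ∑ j, c j ^ 2 * (1 - t j ^ 2) := by
  have h : ∀ j k, c j * c k * (if j = k then 1 else t j * t k) =
      (c j * t j) * (c k * t k) + if j = k then c j ^ 2 * (1 - t j ^ 2) else 0 := by
    intro j k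
    split_ifs with h
    · subst h; ring
    · ring
  simp_rw [h, Finset.sum_add_distrib]
  simp [pow_two, Finset.sum_mul_sum]

variable {n : ℕ} (z : BV n ⊕ BV n → ℝ)

lemma integral_roundKernel_corr :
    ∫ w, corr n (fun y => w (Sum.inl y)) (fun y => w (Sum.inr y)) ∂(roundKernel _ z) =
      avg n fun i => (((Had n).mulVec (fun j => trnc (z (Sum.inl j))) i) ^ 2 +
        (1 - avg n fun j => trnc (z (Sum.inl j)) ^ 2)) * trnc (z (Sum.inr i)) := by
  have hI := fun F => integrable_of_ae_cube (ae_roundKernel z) F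
  have h1 : ∀ w : BV n ⊕ BV n → ℝ,
      corr n (fun y => w (Sum.inl y)) (fun y => w (Sum.inr y)) =
        ∑ i, ∑ j, ∑ k, Had n i j * Had n i k / 2 ^ n *
          (w (Sum.inl j) * w (Sum.inl k) * w (Sum.inr i)) := by
    intro w
    rw [corr]
    refine Finset.sum_congr rfl fun i _ => ?_
    rw [hatF_sq, Matrix.mulVec, dotProduct, pow_two, Finset.sum_mul_sum, Finset.sum_div,
      Finset.sum_mul]
    refine Finset.sum_congr rfl fun j _ => ?_
    rw [Finset.sum_div, Finset.sum_mul]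
    refine Finset.sum_congr rfl fun k _ => ?_
    ring
  simp_rw [h1]
  rw [integral_finsetSum _ fun _ _ => hI _, avg, Finset.sum_div]
  refine Finset.sum_congr rfl fun i _ => ?_
  rw [integral_finsetSum _ fun _ _ => hI _]
  have h2 : ∀ j, ∫ w, ∑ k, Had n i j * Had n i k / 2 ^ n *
      (w (Sum.inl j) * w (Sum.inl k) * w (Sum.inr i)) ∂(roundKernel _ z) =
      ∑ k, Had n i j * Had n i k * (if j = k then 1 else
        trnc (z (Sum.inl j)) * trnc (z (Sum.inl k))) * (trnc (z (Sum.inr i)) / 2 ^ n) := by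
    intro j
    rw [integral_finsetSum _ fun _ _ => hI _]
    refine Finset.sum_congr rfl fun k _ => ?_
    rw [integral_const_mul, integral_roundKernel_triple z _ _ _ (by simp) (by simp)]
    simp only [Sum.inl.injEq]
    ring
  simp_rw [h2, ← Finset.sum_mul]
  rw [sum_sum_ite_eq]
  simp_rw [Had_sq]
  rw [← Finset.mul_sum, Finset.sum_sub_distrib]
  simp only [Matrix.mulVec, dotProduct, avg]
  simp
  field_simp

lemma integral_roundKernel_avg_sq :
    ∫ w, (avg n fun y => w (Sum.inr y)) ^ 2 ∂(roundKernel _ z) ≤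
      1 / 2 ^ n + (avg n fun i => trnc (z (Sum.inr i))) ^ 2 := by
  have hI := fun F => integrable_of_ae_cube (ae_roundKernel z) F
  have h1 : ∀ w : BV n ⊕ BV n → ℝ, (avg n fun y => w (Sum.inr y)) ^ 2 =
      ∑ j, ∑ k, (1 / 2 ^ n) * (1 / 2 ^ n) * (w (Sum.inr j) * w (Sum.inr k)) := by
    intro w
    rw [avg, div_pow, pow_two, Finset.sum_mul_sum]
    simp_rw [← Finset.mul_sum]
    ring
  simp_rw [h1]
  rw [integral_finsetSum _ fun _ _ => hI _]
  have h2 : ∀ j : BV n, ∫ w, ∑ k, (1 / 2 ^ n) * (1 / 2 ^ n) *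
      (w (Sum.inr j) * w (Sum.inr k)) ∂(roundKernel _ z) =
      ∑ k, (1 / 2 ^ n) * (1 / 2 ^ n) * (if j = k then 1 else
        trnc (z (Sum.inr j)) * trnc (z (Sum.inr k))) := by
    intro j
    rw [integral_finsetSum _ fun _ _ => hI _]
    refine Finset.sum_congr rfl fun k _ => ?_
    rw [integral_const_mul, integral_roundKernel_pair]
    simp only [Sum.inr.injEq]
  simp_rw [h2]
  rw [sum_sum_ite_eq (fun _ => 1 / 2 ^ n), ← Finset.mul_sum, ← Finset.mul_sum, avg, add_comm]
  refine add_le_add ?_ (le_of_eq (by ring))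
  have h3 : ∑ j : BV n, (1 - trnc (z (Sum.inr j)) ^ 2) ≤ ∑ j : BV n, 1 :=
    Finset.sum_le_sum fun j _ => by nlinarith [sq_nonneg (trnc (z (Sum.inr j)))]
  have h4 : ∑ j : BV n, (1 : ℝ) = 2 ^ n := by simp
  rw [h4] at h3
  refine (mul_le_mul_of_nonneg_left h3 (by positivity)).trans (le_of_eq ?_)
  field_simp

end ConditionalExpectation

section PointwiseBounds

lemma abs_sub_trnc_le (a : ℝ) {k : ℕ} (hk : k ≠ 0) : |a - trnc a| ≤ |a| ^ k := by
  rcases le_or_gt |a| 1 with h | h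
  · have ht : trnc a = a := by
      rw [trnc, max_eq_right (abs_le.mp h).1, min_eq_right (abs_le.mp h).2]
    rw [ht, sub_self, abs_zero]
    positivity
  · refine le_trans ?_ (le_self_pow₀ h.le hk)
    rcases lt_abs.mp h with h | h
    · have ht : trnc a = 1 := by
        rw [trnc, max_eq_right (by linarith), min_eq_left h.le]
      rw [ht, abs_of_pos (by linarith), abs_of_pos (by linarith)]
      linarith
    · have ht : trnc a = -1 := by
        rw [trnc, max_eq_left (by linarith), min_eq_right (by linarith)]
      rw [ht, abs_of_neg (by linarith), abs_of_neg (by linarith)]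
      linarith

lemma sq_sub_trnc_le (a : ℝ) {k : ℕ} (hk : k ≠ 0) : (a - trnc a) ^ 2 ≤ a ^ (2 * k) := by
  have h := pow_le_pow_left₀ (abs_nonneg _) (abs_sub_trnc_le a hk) 2
  rwa [sq_abs, ← pow_mul, mul_comm k 2, pow_mul, sq_abs, ← pow_mul] at h

lemma avg_sub (n : ℕ) (v w : BV n → ℝ) : (avg n fun i => v i - w i) = avg n v - avg n w := by
  simp [avg, sub_div]

lemma avg_add (n : ℕ) (v w : BV n → ℝ) : (avg n fun i => v i + w i) = avg n v + avg n w := by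
  simp [avg, Finset.sum_add_distrib, add_div]

lemma avg_const_mul (n : ℕ) (c : ℝ) (v : BV n → ℝ) : (avg n fun i => c * v i) = c * avg n v := by
  rw [avg, avg, ← Finset.mul_sum, mul_div_assoc]

lemma avg_const (n : ℕ) (c : ℝ) : (avg n fun _ => c) = c := by
  simp [avg]

lemma avg_mono (n : ℕ) {v w : BV n → ℝ} (h : ∀ i, v i ≤ w i) : avg n v ≤ avg n w :=
  div_le_div_of_nonneg_right (Finset.sum_le_sum fun i _ => h i) (by positivity)

lemma avg_sq_le (n : ℕ) (v : BV n → ℝ) : avg n v ^ 2 ≤ avg n fun i => v i ^ 2 := by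
  have h := sq_sum_le_card_mul_sum_sq (s := (Finset.univ : Finset (BV n))) (f := v)
  simp only [Finset.card_univ, Fintype.card_pi, Fintype.card_bool, Finset.prod_const,
    Fintype.card_fin, Nat.cast_pow, Nat.cast_ofNat] at h
  rw [avg, avg, div_pow, div_le_div_iff₀ (by positivity) (by positivity)]
  nlinarith [pow_pos (two_pos : (0 : ℝ) < 2) n]

lemma avg_Had_mulVec_sq (n : ℕ) (v : BV n → ℝ) :
    (avg n fun i => ((Had n).mulVec v i) ^ 2) = avg n fun i => v i ^ 2 := by
  rw [avg, avg, sum_Had_mulVec_sq]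

variable {n : ℕ} (X : BV n → ℝ) (v : ℝ)

lemma avg_trnc_sq_le :
    (avg n fun i => trnc (((Had n).mulVec X i) ^ 2 - v)) ^ 2 ≤
      2 * ((avg n fun j => X j ^ 2) - v) ^ 2 +
        2 * avg n fun i => (((Had n).mulVec X i) ^ 2 - v) ^ 8 := by
  set a : BV n → ℝ := fun i => ((Had n).mulVec X i) ^ 2 - v with ha
  have hu : avg n a = (avg n fun j => X j ^ 2) - v := by
    rw [ha, avg_sub n (fun i => ((Had n).mulVec X i) ^ 2) fun _ => v, avg_Had_mulVec_sq, avg_const]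
  have hr : (avg n fun i => a i - trnc (a i)) ^ 2 ≤ avg n fun i => a i ^ 8 :=
    (avg_sq_le n _).trans (avg_mono n fun i => sq_sub_trnc_le (a i) (k := 4) (by norm_num))
  rw [avg_sub n a fun i => trnc (a i)] at hr
  change (avg n fun i => trnc (a i)) ^ 2 ≤ _ + 2 * avg n fun i => a i ^ 8
  rw [← hu]
  nlinarith [sq_nonneg (avg n a + (avg n a - avg n fun i => trnc (a i)))]

lemma avg_corr_lower (θ : ℝ) (hθ : 0 < θ) :
    (avg n fun i => ((Had n).mulVec X i) ^ 2 * (((Had n).mulVec X i) ^ 2 - v)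
        - ((Had n).mulVec X i) ^ 2 * (((Had n).mulVec X i) ^ 2 - v) ^ 4
        - θ * ((Had n).mulVec X i) ^ 2) - (1 + 1 / θ) * (avg n fun j => X j ^ 10) ≤
      avg n fun i => ((Had n).mulVec (fun j => trnc (X j)) i) ^ 2 *
        trnc (((Had n).mulVec X i) ^ 2 - v) := by
  set Y := (Had n).mulVec X with hY
  set d : BV n → ℝ := (Had n).mulVec (fun j => X j - trnc (X j)) with hd
  have hT : ∀ i, (Had n).mulVec (fun j => trnc (X j)) i = Y i - d i := by
    intro i
    have : (fun j => X j - trnc (X j)) = X - fun j => trnc (X j) := rfl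
    rw [hd, hY, this, Matrix.mulVec_sub, Pi.sub_apply]
    ring
  have hd2 : (avg n fun i => d i ^ 2) ≤ avg n fun j => X j ^ 10 := by
    rw [hd, avg_Had_mulVec_sq]
    exact avg_mono n fun j => sq_sub_trnc_le (X j) (k := 5) (by norm_num)
  have hc : 0 ≤ 1 + 1 / θ := by positivity
  have hpt : ∀ i, Y i ^ 2 * (Y i ^ 2 - v) - Y i ^ 2 * (Y i ^ 2 - v) ^ 4 - θ * Y i ^ 2
      - (1 + 1 / θ) * d i ^ 2 ≤ (Y i - d i) ^ 2 * trnc (Y i ^ 2 - v) := by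
    intro i
    set a := Y i ^ 2 - v with ha
    have h1 : a - a ^ 4 ≤ trnc a := by
      have := (le_abs_self _).trans (abs_sub_trnc_le a (k := 4) (by norm_num))
      rw [Even.pow_abs (by decide)] at this
      linarith
    have h2 : Y i ^ 2 * (a - a ^ 4) ≤ Y i ^ 2 * trnc a :=
      mul_le_mul_of_nonneg_left h1 (sq_nonneg _)
    have h3 : |2 * Y i * d i - d i ^ 2| ≤ θ * Y i ^ 2 + (1 + 1 / θ) * d i ^ 2 := by
      have h4 : ∀ s : ℝ, 2 * s ≤ θ * s ^ 2 + 1 / θ := by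
        intro s
        have : θ * s ^ 2 + 1 / θ - 2 * s = (θ * s - 1) ^ 2 / θ := by field_simp; ring
        have h5 : 0 ≤ (θ * s - 1) ^ 2 / θ := by positivity
        linarith
      have h6 : ∀ s : ℝ, 2 * s * d i ≤ θ * s ^ 2 + 1 / θ * d i ^ 2 := by
        intro s
        have : θ * s ^ 2 + 1 / θ * d i ^ 2 - 2 * s * d i = (θ * s - d i) ^ 2 / θ := by
          field_simp; ring
        have h5 : 0 ≤ (θ * s - d i) ^ 2 / θ := by positivity
        linarith
      have h7 := h6 (Y i)
      have h8 := h6 (-Y i)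
      rw [abs_le]
      constructor <;> nlinarith [sq_nonneg (d i)]
    have h9 : |(2 * Y i * d i - d i ^ 2) * trnc a| ≤ θ * Y i ^ 2 + (1 + 1 / θ) * d i ^ 2 := by
      rw [abs_mul]
      have : |trnc a| ≤ 1 := abs_le.mpr ⟨neg_one_le_trnc a, trnc_le_one a⟩
      exact (mul_le_of_le_one_right (abs_nonneg _) this).trans h3
    have h10 := (le_abs_self _).trans h9
    nlinarith
  simp_rw [hT]
  refine le_trans ?_ (avg_mono n hpt)
  rw [avg_sub n (fun i => Y i ^ 2 * (Y i ^ 2 - v) - Y i ^ 2 * (Y i ^ 2 - v) ^ 4 - θ * Y i ^ 2),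
    avg_const_mul]
  gcongr

end PointwiseBounds

section ConditionalLower

/-- The polynomial in a coordinate of the Hadamard transform that enters the lower bound. -/
def outPoly (v η θ y : ℝ) : ℝ :=
  y ^ 2 * (y ^ 2 - v) - y ^ 2 * (y ^ 2 - v) ^ 4 - θ * y ^ 2 - 4 / η * (y ^ 2 - v) ^ 8

/-- A polynomial lower bound for the conditional expectation given the Gaussian vector. -/
def lowerPoly (n : ℕ) (v η θ m : ℝ) (X : BV n → ℝ) : ℝ :=
  (1 - m - 2 * η - 1 / 2 ^ n / η) - 4 / η * ((avg n fun j => X j ^ 2) - v) ^ 2 +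
    (avg n fun i => outPoly v η θ ((Had n).mulVec X i)) -
    (1 + 1 / θ) * avg n fun j => X j ^ 10

lemma lowerPoly_le_integral {n : ℕ} (X : BV n → ℝ) (v η θ m : ℝ) (hη : 0 < η) (hθ : 0 < θ) :
    lowerPoly n v η θ m X ≤
      ∫ w, (1 + corr n (fun y => w (Sum.inl y)) (fun y => w (Sum.inr y)) - m - η -
          (avg n fun y => w (Sum.inr y)) ^ 2 / η)
        ∂(roundKernel _ (Sum.elim X fun i => ((Had n).mulVec X i) ^ 2 - v)) := by
  set z : BV n ⊕ BV n → ℝ := Sum.elim X fun i => ((Had n).mulVec X i) ^ 2 - v with hz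
  have hI := fun F => integrable_of_ae_cube (ae_roundKernel z) F
  rw [integral_sub (hI _) (hI _), integral_sub (hI _) (hI _), integral_sub (hI _) (hI _),
    integral_add (hI _) (hI _), integral_roundKernel_corr, integral_div]
  have h1 := integral_roundKernel_avg_sq z
  simp only [integral_const, probReal_univ, one_smul]
  have h2 := div_le_div_of_nonneg_right h1 hη.le
  simp only [hz, Sum.elim_inl, Sum.elim_inr] at h2 ⊢
  have h3 := avg_trnc_sq_le X v
  have h4 := avg_corr_lower X v θ hθ
  set T := avg n fun i => trnc (((Had n).mulVec X i) ^ 2 - v) with hT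
  set A := avg n fun j => trnc (X j) ^ 2 with hA
  have hA0 : 0 ≤ A := by
    rw [← avg_const n 0]; exact avg_mono n fun j => sq_nonneg _
  have hA1 : A ≤ 1 := by
    rw [← avg_const n 1]; exact avg_mono n fun j => trnc_sq_le_one _
  simp_rw [add_mul]
  rw [avg_add, avg_const_mul, ← hT]
  have h5 : |T| ≤ η + T ^ 2 / η := by
    have h : η + T ^ 2 / η - 2 * |T| = (η - |T|) ^ 2 / η := by
      field_simp
      rw [sub_sq, sq_abs]; ring
    have h' : 0 ≤ (η - |T|) ^ 2 / η := by positivity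
    linarith [abs_nonneg T]
  have h6 : -|T| ≤ (1 - A) * T := by
    have : |(1 - A) * T| ≤ |T| := by
      rw [abs_mul]
      exact mul_le_of_le_one_left (abs_nonneg _) (abs_le.mpr ⟨by linarith, by linarith⟩)
    linarith [neg_abs_le ((1 - A) * T)]
  have h7 : T ^ 2 / η ≤ 2 / η * ((avg n fun j => X j ^ 2) - v) ^ 2 +
      2 / η * avg n fun i => (((Had n).mulVec X i) ^ 2 - v) ^ 8 := by
    refine (div_le_div_of_nonneg_right h3 hη.le).trans (le_of_eq (by ring))
  rw [lowerPoly]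
  simp only [outPoly]
  rw [avg_sub n (fun i => ((Had n).mulVec X i) ^ 2 * (((Had n).mulVec X i) ^ 2 - v)
        - ((Had n).mulVec X i) ^ 2 * (((Had n).mulVec X i) ^ 2 - v) ^ 4
        - θ * ((Had n).mulVec X i) ^ 2), avg_const_mul]
  rw [add_div] at h2
  have e4 : (4 : ℝ) / η = 2 * (2 / η) := by ring
  rw [e4]
  linarith

end ConditionalLower

section GaussianMoments

open scoped NNReal

lemma integrable_pow_gaussianReal (μ : ℝ) (v : ℝ≥0) (k : ℕ) :
    Integrable (fun x => x ^ k) (gaussianReal μ v) := by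
  have h := (memLp_id_gaussianReal (μ := μ) (v := v) k).integrable_norm_pow'
  rw [← integrable_norm_iff (by fun_prop)]
  simpa using h

lemma integrable_eval_gaussianReal (μ : ℝ) (v : ℝ≥0) (p : Polynomial ℝ) :
    Integrable (fun x => p.eval x) (gaussianReal μ v) := by
  simp_rw [Polynomial.eval_eq_sum_range]
  exact integrable_finsetSum _ fun i _ => (integrable_pow_gaussianReal μ v i).const_mul _

lemma integral_gaussianReal_scale {v : ℝ} (hv : 0 ≤ v) {f : ℝ → ℝ} (hf : Continuous f) :
    ∫ x, f x ∂(gaussianReal 0 v.toNNReal) = ∫ x, f (Real.sqrt v * x) ∂(gaussianReal 0 1) := by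
  have h := gaussianReal_map_const_mul (μ := 0) (v := 1) (Real.sqrt v)
  have h2 : NNReal.mk (Real.sqrt v ^ 2) (sq_nonneg _) * 1 = v.toNNReal := by
    ext
    simp [Real.sq_sqrt hv, hv]
  rw [h2, mul_zero] at h
  rw [← h, integral_map (by fun_prop) hf.aestronglyMeasurable]

lemma integral_sq_gaussianReal_one : ∫ x, x ^ 2 ∂(gaussianReal 0 1) = 1 := by
  have h := variance_fun_id_gaussianReal (μ := 0) (v := 1)
  rw [variance_of_integral_eq_zero (by fun_prop) (by simp)] at h
  simpa using h

lemma integral_pow_four_gaussianReal_one : ∫ x, x ^ 4 ∂(gaussianReal 0 1) = 3 := by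
  have h : iteratedDeriv 4 (mgf id (gaussianReal 0 1)) 0 = ∫ x, x ^ 4 ∂(gaussianReal 0 1) := by
    rw [iteratedDeriv_mgf_zero (by simp)]
    simp
  rw [← h, mgf_id_gaussianReal]
  have hd : ∀ p : Polynomial ℝ, deriv (fun t => p.eval t * Real.exp (t ^ 2 / 2)) =
      fun t => (Polynomial.derivative p + Polynomial.X * p).eval t * Real.exp (t ^ 2 / 2) := by
    intro p
    ext t
    have h1 : HasDerivAt (fun t : ℝ => t ^ 2 / 2) t t := by
      simpa using ((hasDerivAt_id t).pow 2).div_const 2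
    have h2 : HasDerivAt (fun t => p.eval t * Real.exp (t ^ 2 / 2)) _ t :=
      (p.hasDerivAt t).mul h1.exp
    rw [h2.deriv, Polynomial.eval_add, Polynomial.eval_mul, Polynomial.eval_X]
    ring
  have h0 : (fun t : ℝ => Real.exp (0 * t + ((1 : ℝ≥0) : ℝ) * t ^ 2 / 2)) =
      fun t => (1 : Polynomial ℝ).eval t * Real.exp (t ^ 2 / 2) := by
    ext t; simp
  rw [h0, iteratedDeriv_succ', iteratedDeriv_succ', iteratedDeriv_succ', iteratedDeriv_succ',
    iteratedDeriv_zero, hd, hd, hd, hd]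
  simp
  norm_num

end GaussianMoments

section GaussianVector

variable {n : ℕ} (v : ℝ)

/-- The law of a vector of i.i.d. centred Gaussians of variance `v`. -/
def gaussPi (n : ℕ) (v : ℝ) : Measure (BV n → ℝ) :=
  Measure.pi fun _ => gaussianReal 0 v.toNNReal

instance : IsProbabilityMeasure (gaussPi n v) := by
  unfold gaussPi; infer_instance

lemma map_eval_gaussPi (j : BV n) :
    (gaussPi n v).map (fun X => X j) = gaussianReal 0 v.toNNReal :=
  (measurePreserving_eval (fun _ : BV n => gaussianReal 0 v.toNNReal) j).map_eq

lemma measurable_mulVec (i : BV n) : Measurable fun X : BV n → ℝ => (Had n).mulVec X i := by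
  unfold Matrix.mulVec dotProduct
  fun_prop

lemma map_mulVec_gaussPi (i : BV n) :
    (gaussPi n v).map (fun X => (Had n).mulVec X i) = gaussianReal 0 v.toNNReal := by
  have hlaw : ∀ j, HasGaussianLaw (fun X : BV n → ℝ => Had n i j * X j) (gaussPi n v) := by
    intro j
    have : HasGaussianLaw (fun X : BV n → ℝ => X j) (gaussPi n v) :=
      ⟨by rw [map_eval_gaussPi]; infer_instance⟩
    exact this.fun_smul (Had n i j)
  have hindep : iIndepFun (fun j (X : BV n → ℝ) => Had n i j * X j) (gaussPi n v) :=
    iIndepFun_pi (X := fun j x => Had n i j * x) fun j => by fun_prop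
  have hsum := hindep.hasGaussianLaw_fun_sum hlaw
  have hmemLp : MemLp (fun x : ℝ => x) 2 (gaussianReal 0 v.toNNReal) := memLp_id_gaussianReal 2
  have hvar := variance_sum_pi (μ := fun _ : BV n => gaussianReal 0 v.toNNReal)
    (X := fun j x => Had n i j * x) fun j => hmemLp.const_mul _
  have hfun : (∑ j, fun X : BV n → ℝ => Had n i j * X j) = fun X => ∑ j, Had n i j * X j := by
    ext X; simp
  rw [hfun] at hvar
  have hvar1 : ∀ j, Var[fun x => Had n i j * x; gaussianReal 0 v.toNNReal] =
      Had n i j ^ 2 * v.toNNReal := by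
    intro j
    rw [variance_const_mul, variance_fun_id_gaussianReal]
  rw [Finset.sum_congr rfl fun j _ => hvar1 j, ← Finset.sum_mul, sum_Had_sq, one_mul] at hvar
  have hmean : ∫ X, ∑ j, Had n i j * X j ∂(gaussPi n v) = 0 := by
    rw [integral_finsetSum _ fun j _ => (hlaw j).integrable]
    refine Finset.sum_eq_zero fun j _ => ?_
    rw [integral_const_mul]
    have h := integral_map (μ := gaussPi n v) (φ := fun X => X j) (f := fun x : ℝ => x)
      (measurable_pi_apply j).aemeasurable (by fun_prop)
    rw [← h, map_eval_gaussPi, integral_id_gaussianReal, mul_zero]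
  have h := hsum.map_eq_gaussianReal
  rw [hmean] at h
  change Measure.map (fun X : BV n → ℝ => ∑ j, Had n i j * X j) (gaussPi n v) = _
  rw [h]
  congr 1
  change (Var[fun X : BV n → ℝ => ∑ j, Had n i j * X j;
    Measure.pi fun _ => gaussianReal 0 v.toNNReal]).toNNReal = _
  rw [hvar, Real.toNNReal_coe]

lemma integral_avg_of_map_eq {φ : BV n → (BV n → ℝ) → ℝ} {ν : Measure ℝ}
    (hφ : ∀ i, Measurable (φ i)) (hmap : ∀ i, (gaussPi n v).map (φ i) = ν)
    {f : ℝ → ℝ} (hf : Integrable f ν) :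
    Integrable (fun X => avg n fun i => f (φ i X)) (gaussPi n v) ∧
      ∫ X, (avg n fun i => f (φ i X)) ∂(gaussPi n v) = ∫ x, f x ∂ν := by
  have hi : ∀ i, Integrable (fun X => f (φ i X)) (gaussPi n v) := by
    intro i
    rw [← hmap i] at hf
    exact hf.comp_measurable (hφ i)
  unfold avg
  refine ⟨(integrable_finsetSum _ fun i _ => hi i).div_const _, ?_⟩
  rw [integral_div, integral_finsetSum _ fun i _ => hi i]
  have h : ∀ i, ∫ X, f (φ i X) ∂(gaussPi n v) = ∫ x, f x ∂ν := by
    intro i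
    rw [← hmap i] at hf ⊢
    rw [integral_map (hφ i).aemeasurable hf.aestronglyMeasurable]
  simp [h]

end GaussianVector

section Expectation

open scoped NNReal

lemma integrable_of_polynomial {μ : ℝ} {v : ℝ≥0} {f : ℝ → ℝ} (p : Polynomial ℝ)
    (h : ∀ x, f x = p.eval x) : Integrable f (gaussianReal μ v) := by
  rw [funext h]
  exact integrable_eval_gaussianReal μ v p

lemma integrable_outPoly (v η θ : ℝ) (w : ℝ≥0) :
    Integrable (outPoly v η θ) (gaussianReal 0 w) := by
  refine integrable_of_polynomial (.X ^ 2 * (.X ^ 2 - .C v) -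
    .X ^ 2 * (.X ^ 2 - .C v) ^ 4 - .C θ * .X ^ 2 - .C (4 / η) * (.X ^ 2 - .C v) ^ 8) fun x => ?_
  simp [outPoly]

lemma integral_outPoly {v : ℝ} (hv : 0 ≤ v) (η θ : ℝ) :
    ∫ y, outPoly v η θ y ∂(gaussianReal 0 v.toNNReal) =
      2 * v ^ 2 - v ^ 5 * (∫ x, x ^ 2 * (x ^ 2 - 1) ^ 4 ∂(gaussianReal 0 1)) - θ * v -
        4 / η * (v ^ 8 * ∫ x, (x ^ 2 - 1) ^ 8 ∂(gaussianReal 0 1)) := by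
  rw [integral_gaussianReal_scale hv (by unfold outPoly; fun_prop)]
  have h : ∀ x : ℝ, outPoly v η θ (Real.sqrt v * x) =
      v ^ 2 * x ^ 4 - v ^ 2 * x ^ 2 - v ^ 5 * (x ^ 2 * (x ^ 2 - 1) ^ 4) - θ * v * x ^ 2 -
        4 / η * v ^ 8 * (x ^ 2 - 1) ^ 8 := by
    intro x
    rw [outPoly, mul_pow, Real.sq_sqrt hv]
    ring
  have i1 : Integrable (fun x : ℝ => x ^ 2 * (x ^ 2 - 1) ^ 4) (gaussianReal 0 1) :=
    integrable_of_polynomial (.X ^ 2 * (.X ^ 2 - 1) ^ 4) fun x => by simp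
  have i2 : Integrable (fun x : ℝ => (x ^ 2 - 1) ^ 8) (gaussianReal 0 1) :=
    integrable_of_polynomial ((.X ^ 2 - 1) ^ 8) fun x => by simp
  have i3 := integrable_pow_gaussianReal 0 1 2
  have i4 := integrable_pow_gaussianReal 0 1 4
  simp_rw [h]
  rw [integral_sub, integral_sub, integral_sub, integral_sub]
  · simp only [integral_const_mul, integral_sq_gaussianReal_one,
      integral_pow_four_gaussianReal_one]
    ring
  all_goals fun_prop

variable {n : ℕ} {v : ℝ}

lemma integral_avg_sq_sub_sq (hv : 0 ≤ v) :
    Integrable (fun X => ((avg n fun j => X j ^ 2) - v) ^ 2) (gaussPi n v) ∧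
    ∫ X, ((avg n fun j => X j ^ 2) - v) ^ 2 ∂(gaussPi n v) =
      v ^ 2 * Var[fun x => x ^ 2; gaussianReal 0 1] / 2 ^ n := by
  have hm : ∀ w : ℝ≥0, MemLp (fun x : ℝ => x ^ 2) 2 (gaussianReal 0 w) := by
    intro w
    rw [memLp_two_iff_integrable_sq (by fun_prop)]
    exact integrable_of_polynomial (.X ^ 4) fun x => by simp; ring
  have hmj : ∀ j : BV n, MemLp (fun X : BV n → ℝ => X j ^ 2) 2 (gaussPi n v) := fun j =>
    (hm v.toNNReal).comp_measurePreserving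
      (measurePreserving_eval (fun _ : BV n => gaussianReal 0 v.toNNReal) j)
  have hs : MemLp (fun X : BV n → ℝ => ∑ j, X j ^ 2) 2 (gaussPi n v) :=
    memLp_finsetSum _ fun j _ => hmj j
  have ha : MemLp (fun X : BV n → ℝ => avg n fun j => X j ^ 2) 2 (gaussPi n v) := by
    have := hs.const_mul (1 / 2 ^ n)
    refine this.ae_eq (ae_of_all _ fun X => ?_)
    simp only [avg]; ring
  have h2 : ∫ x, x ^ 2 ∂(gaussianReal 0 v.toNNReal) = v := by
    rw [integral_gaussianReal_scale hv (by fun_prop)]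
    simp_rw [mul_pow, Real.sq_sqrt hv]
    rw [integral_const_mul, integral_sq_gaussianReal_one, mul_one]
  have hmean : ∫ X, (avg n fun j => X j ^ 2) ∂(gaussPi n v) = v := by
    rw [(integral_avg_of_map_eq (n := n) v (φ := fun j X => X j) (f := fun x => x ^ 2)
      (fun j => measurable_pi_apply j) (map_eval_gaussPi v)
      (integrable_pow_gaussianReal 0 _ 2)).2, h2]
  have hv1 : Var[fun x => x ^ 2; gaussianReal 0 v.toNNReal] =
      v ^ 2 * Var[fun x => x ^ 2; gaussianReal 0 1] := by
    rw [variance_eq_integral (by fun_prop), variance_eq_integral (by fun_prop), h2,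
      integral_sq_gaussianReal_one, integral_gaussianReal_scale hv (by fun_prop),
      ← integral_const_mul]
    congr 1
    ext x
    rw [mul_pow, Real.sq_sqrt hv]
    ring
  refine ⟨(ha.sub (memLp_const v)).integrable_sq, ?_⟩
  have h := variance_eq_integral (μ := gaussPi n v) ha.aemeasurable
  rw [hmean] at h
  rw [← h]
  have hsum := variance_sum_pi (μ := fun _ : BV n => gaussianReal 0 v.toNNReal)
    (X := fun _ x => x ^ 2) fun _ => hm _
  have hfun : (∑ j, fun X : BV n → ℝ => X j ^ 2) = fun X => ∑ j, X j ^ 2 := by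
    ext X; simp
  rw [hfun] at hsum
  have he : (fun X : BV n → ℝ => avg n fun j => X j ^ 2) =
      fun X => (1 / 2 ^ n) * ∑ j, X j ^ 2 := by
    ext X; simp only [avg]; ring
  rw [he, variance_const_mul, gaussPi, hsum, hv1]
  simp
  field_simp

lemma integral_lowerPoly (hv : 0 ≤ v) (η θ m : ℝ) :
    Integrable (lowerPoly n v η θ m) (gaussPi n v) ∧
    ∫ X, lowerPoly n v η θ m X ∂(gaussPi n v) =
      (1 - m - 2 * η - 1 / 2 ^ n / η) -
        4 / η * (v ^ 2 * Var[fun x => x ^ 2; gaussianReal 0 1] / 2 ^ n) +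
        (2 * v ^ 2 - v ^ 5 * (∫ x, x ^ 2 * (x ^ 2 - 1) ^ 4 ∂(gaussianReal 0 1)) - θ * v -
          4 / η * (v ^ 8 * ∫ x, (x ^ 2 - 1) ^ 8 ∂(gaussianReal 0 1))) -
        (1 + 1 / θ) * (v ^ 5 * ∫ x, x ^ 10 ∂(gaussianReal 0 1)) := by
  obtain ⟨i1, e1⟩ := integral_avg_sq_sub_sq (n := n) hv
  obtain ⟨i2, e2⟩ := integral_avg_of_map_eq (n := n) v (φ := fun i X => (Had n).mulVec X i)
    measurable_mulVec (map_mulVec_gaussPi v) (integrable_outPoly v η θ v.toNNReal)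
  obtain ⟨i3, e3⟩ := integral_avg_of_map_eq (n := n) v (φ := fun j X => X j) (f := fun x => x ^ 10)
    (fun j => measurable_pi_apply j) (map_eval_gaussPi v) (integrable_pow_gaussianReal 0 _ 10)
  have e4 : ∫ x, x ^ 10 ∂(gaussianReal 0 v.toNNReal) =
      v ^ 5 * ∫ x, x ^ 10 ∂(gaussianReal 0 1) := by
    rw [integral_gaussianReal_scale hv (by fun_prop), ← integral_const_mul]
    congr 1
    ext x
    rw [mul_pow, show 10 = 2 * 5 by rfl, pow_mul (Real.sqrt v), Real.sq_sqrt hv]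
  rw [e4] at e3
  rw [integral_outPoly hv] at e2
  have j1 := i1.const_mul (4 / η)
  have j3 := i3.const_mul (1 + 1 / θ)
  have j0 : Integrable (fun _ : BV n → ℝ => 1 - m - 2 * η - 1 / 2 ^ n / η) (gaussPi n v) :=
    integrable_const _
  unfold lowerPoly
  refine ⟨((j0.sub j1).add i2).sub j3, ?_⟩
  refine (integral_sub ((j0.sub j1).add i2) j3).trans ?_
  refine congrArg₂ (· - ·) ((integral_add (j0.sub j1) i2).trans ?_) ?_
  · refine congrArg₂ (· + ·) ((integral_sub j0 j1).trans ?_) e2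
    rw [integral_const_mul, e1]
    simp
  · rw [integral_const_mul, e3]

end Expectation

section Main

lemma Dmeas_eq (C : ℝ) (n : ℕ) : Dmeas C n = (Gmeas' C n).bind (roundKernel _) := rfl

lemma measurable_gaussEmb (n : ℕ) (v : ℝ) :
    Measurable fun X : BV n → ℝ =>
      (Sum.elim X fun i => ((Had n).mulVec X i) ^ 2 - v : BV n ⊕ BV n → ℝ) := by
  refine measurable_pi_iff.mpr fun i => ?_
  rcases i with i | i
  · exact measurable_pi_apply i
  · exact ((measurable_mulVec i).pow_const 2).sub_const v

lemma integral_Dmeas_lower (C : ℝ) (n : ℕ) (hv : 0 ≤ eps C n) (η θ : ℝ) (hη : 0 < η)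
    (hθ : 0 < θ) :
    (∫ X, lowerPoly n (eps C n) η θ (2 * (1 / 2) ^ (4 * n ^ 2)) X ∂(gaussPi n (eps C n))) / 2 ^ n ≤
      ∫ z, ∑ x : BV n, hatF n (fun y => z (Sum.inl y)) x ^ 2 *
        rejProb n (fun y => z (Sum.inr y)) x ∂(Dmeas C n) := by
  have hG : Gmeas' C n = (gaussPi n (eps C n)).map fun X =>
      Sum.elim X fun i => ((Had n).mulVec X i) ^ 2 - eps C n := rfl
  have hmeas := measurable_gaussEmb n (eps C n)
  have : IsProbabilityMeasure (Gmeas' C n) := by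
    rw [hG]; exact Measure.isProbabilityMeasure_map hmeas.aemeasurable
  have hprob : IsProbabilityMeasure ((Gmeas' C n).bind (roundKernel (BV n ⊕ BV n))) := by
    infer_instance
  rw [Dmeas_eq]
  have hae := ae_bind_roundKernel (μ := Gmeas' C n)
  have hI := fun F => integrable_of_ae_cube hae F
  set m : ℝ := 2 * (1 / 2) ^ (4 * n ^ 2) with hm
  set F : (BV n ⊕ BV n → ℝ) → ℝ := fun w =>
    1 + corr n (fun y => w (Sum.inl y)) (fun y => w (Sum.inr y)) - m - η -
      (avg n fun y => w (Sum.inr y)) ^ 2 / η with hF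
  have h1 : ∫ w, F w / 2 ^ n ∂((Gmeas' C n).bind (roundKernel _)) ≤
      ∫ z, ∑ x : BV n, hatF n (fun y => z (Sum.inl y)) x ^ 2 *
        rejProb n (fun y => z (Sum.inr y)) x ∂((Gmeas' C n).bind (roundKernel _)) := by
    refine integral_mono_ae (hI _) (hI _) ?_
    filter_upwards [hae] with w hw
    exact rejection_lower n _ _ (fun x => hw _) (fun x => hw _) η hη
  refine le_trans ?_ h1
  rw [integral_div]
  refine div_le_div_of_nonneg_right ?_ (by positivity)
  obtain ⟨hint, heq⟩ := integral_bind_roundKernel F (hI F)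
  rw [heq]
  rw [hG] at hint ⊢
  rw [integral_map hmeas.aemeasurable hint.aestronglyMeasurable]
  refine integral_mono (integral_lowerPoly hv η θ m).1 (hint.comp_measurable hmeas) fun X => ?_
  exact lowerPoly_le_integral X (eps C n) η θ m hη hθ

lemma exists_main_bound (a b c d : ℝ) (ha : 0 ≤ a) (hb : 0 ≤ b) (hc : 0 ≤ c) (hd : 0 ≤ d) :
    ∃ δ > 0, ∀ v r m : ℝ, 0 < v → v ≤ δ → 0 ≤ r → r ≤ v ^ 6 → m ≤ 2 * r →
      1 + v ^ 2 / 8 ≤ (1 - m - 2 * v ^ 3 - r / v ^ 3) - 4 / v ^ 3 * (v ^ 2 * a * r) +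
        (2 * v ^ 2 - v ^ 5 * b - v ^ 2 * v - 4 / v ^ 3 * (v ^ 8 * c)) -
        (1 + 1 / v ^ 2) * (v ^ 5 * d) := by
  have hK : 0 < 6 + 4 * a + b + 4 * c + 2 * d := by positivity
  refine ⟨min 1 (1 / (6 + 4 * a + b + 4 * c + 2 * d)), by positivity, ?_⟩
  intro v r m hv hvd hr hrv hm
  have hv1 : v ≤ 1 := hvd.trans (min_le_left _ _)
  have hvK : v * (6 + 4 * a + b + 4 * c + 2 * d) ≤ 1 := by
    rw [← le_div_iff₀ hK]
    exact hvd.trans (min_le_right _ _)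
  have p5 : v ^ 5 ≤ v ^ 3 := pow_le_pow_of_le_one hv.le hv1 (by norm_num)
  have p6 : v ^ 6 ≤ v ^ 3 := pow_le_pow_of_le_one hv.le hv1 (by norm_num)
  have t1 : r / v ^ 3 ≤ v ^ 3 := by
    rw [div_le_iff₀ (by positivity)]
    exact hrv.trans (le_of_eq (by ring))
  have t2 : 4 / v ^ 3 * (v ^ 2 * a * r) ≤ 4 * a * v ^ 3 := by
    have e : 4 / v ^ 3 * (v ^ 2 * a * r) = 4 * a * (v ^ 2 * (r / v ^ 3)) := by ring
    rw [e]
    refine mul_le_mul_of_nonneg_left ?_ (by positivity)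
    have : v ^ 2 ≤ 1 := pow_le_one₀ hv.le hv1
    exact (mul_le_of_le_one_left (by positivity) this).trans t1
  have t3 : v ^ 5 * b ≤ b * v ^ 3 := by nlinarith
  have t4 : 4 / v ^ 3 * (v ^ 8 * c) ≤ 4 * c * v ^ 3 := by
    have e : 4 / v ^ 3 * (v ^ 8 * c) = 4 * c * v ^ 5 := by field_simp
    rw [e]
    exact mul_le_mul_of_nonneg_left p5 (by positivity)
  have t5 : (1 + 1 / v ^ 2) * (v ^ 5 * d) ≤ 2 * d * v ^ 3 := by
    have e : (1 + 1 / v ^ 2) * (v ^ 5 * d) = d * v ^ 5 + d * v ^ 3 := by field_simp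
    rw [e]
    nlinarith
  have t6 : m ≤ 2 * v ^ 3 := by linarith
  have t7 := mul_le_mul_of_nonneg_left hvK (sq_nonneg v)
  have t8 : 0 ≤ v ^ 2 := sq_nonneg v
  nlinarith

lemma tendsto_eps (C : ℝ) :
    Filter.Tendsto (fun n : ℕ => eps C n) Filter.atTop (nhds 0) := by
  have h : (fun n : ℕ => eps C n) = fun n : ℕ => (1 / (C * Real.log 2)) / (n : ℝ) := by
    ext n
    rw [eps, Real.log_pow, div_div]
    ring_nf
  rw [h]
  exact tendsto_const_div_atTop_nhds_zero_nat _

lemma eventually_le_eps_pow {C : ℝ} (hC : 0 < C) :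
    ∀ᶠ n : ℕ in Filter.atTop, 1 / 2 ^ n ≤ eps C n ^ 6 := by
  have h := tendsto_pow_const_div_const_pow_of_one_lt 6 (by norm_num : (1 : ℝ) < 2)
  have hl : 0 < Real.log 2 := Real.log_pos (by norm_num)
  have hc : 0 < 1 / (C * Real.log 2) ^ 6 := by positivity
  filter_upwards [h.eventually (gt_mem_nhds hc), Filter.eventually_gt_atTop 0] with n hn hn0
  have hn0' : (0 : ℝ) < n := by exact_mod_cast hn0
  rw [eps, Real.log_pow, div_pow, one_pow]
  rw [div_lt_div_iff₀ (by positivity) (by positivity)] at hn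
  rw [div_le_div_iff₀ (by positivity) (by positivity)]
  calc 1 * (C * (n * Real.log 2)) ^ 6 = n ^ 6 * (C * Real.log 2) ^ 6 := by ring
    _ ≤ 1 * 2 ^ n := hn.le

end Main

/-- There exists a constant `C₀ ≥ 20` such that for every `C ≥ C₀` and all
sufficiently large `N`: `E_{f, x ~ C_f}[Pr[R_f outputs x]] ≥ (1 + ε²/8)/N`. Here `f` is
the first half of a sample `(f, g) ~ D`; `x ~ C_f` is drawn with probability `f̂(x)²`;
and `R_f` samples `g ~ D_f` (the conditional of `D` given `f`) and then rejection-samples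
using `g` — so, averaging over `f` and `g ~ D_f` jointly amounts to averaging over
`(f, g) ~ D`. -/
theorem stmt17 :
    ∃ C₀ : ℝ, 20 ≤ C₀ ∧
      ∀ C : ℝ, C₀ ≤ C → ∃ n₀ : ℕ, ∀ n : ℕ, n₀ ≤ n →
        (1 + eps C n ^ 2 / 8) / 2 ^ n ≤
          ∫ z, ∑ x : BV n,
              hatF n (fun y => z (Sum.inl y)) x ^ 2 *
                rejProb n (fun y => z (Sum.inr y)) x ∂(Dmeas C n) := by
  refine ⟨20, le_rfl, fun C hC => ?_⟩
  have hC0 : 0 < C := by linarith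
  obtain ⟨δ, hδ, hbound⟩ := exists_main_bound
    (Var[fun x => x ^ 2; gaussianReal 0 1])
    (∫ x, x ^ 2 * (x ^ 2 - 1) ^ 4 ∂(gaussianReal 0 1))
    (∫ x, (x ^ 2 - 1) ^ 8 ∂(gaussianReal 0 1))
    (∫ x, x ^ 10 ∂(gaussianReal 0 1))
    (variance_nonneg _ _) (integral_nonneg fun x => by positivity)
    (integral_nonneg fun x => Even.pow_nonneg (by decide) _)
    (integral_nonneg fun x => Even.pow_nonneg (by decide) _)
  have hev := ((tendsto_eps C).eventually (gt_mem_nhds hδ)).and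
    ((eventually_le_eps_pow hC0).and (Filter.eventually_gt_atTop 0))
  obtain ⟨n₀, hn₀⟩ := Filter.eventually_atTop.mp hev
  refine ⟨n₀, fun n hn => ?_⟩
  obtain ⟨h1, h2, h3⟩ := hn₀ n hn
  have hv : 0 < eps C n := by
    have : 0 < Real.log (2 ^ n) := Real.log_pos (one_lt_pow₀ (by norm_num) h3.ne')
    unfold eps
    positivity
  refine le_trans ?_ (integral_Dmeas_lower C n hv.le (eps C n ^ 3) (eps C n ^ 2)
    (by positivity) (by positivity))
  refine div_le_div_of_nonneg_right ?_ (by positivity)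
  rw [(integral_lowerPoly hv.le _ _ _).2]
  refine (hbound (eps C n) (1 / 2 ^ n) (2 * (1 / 2) ^ (4 * n ^ 2)) hv h1.le (by positivity) h2
    ?_).trans (le_of_eq (by ring))
  rw [← one_div_pow]
  refine mul_le_mul_of_nonneg_left ?_ (by norm_num)
  exact pow_le_pow_of_le_one (by norm_num) (by norm_num) (by nlinarith)
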